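/- Let q be a Boolean conjunctive query without self-join and F ∈ q an atom with key(F) = ∅. Let q' = q \ {F}, and let y⃗ be a sequence of distinct variables whose set of entries is vars(F). Let db be an uncertain database that is purified relative to q, and let D be the active domain of db. Then the following are equivalent: (1) db ∈ CERTAINTY(q); (2) db ≠ ∅ and for every tuple b⃗ of constants from D of length |y⃗|: if F[y⃗→b⃗] ∈ db, then db ∈ CERTAINTY(q'[y⃗→b⃗]). -/

import Mathlib

attribute [local instance] Classical.propDecidable

noncomputable section

/-- A term is either a variable (`Sum.inl v`) or a constant (`Sum.inr c`),
variables and constants both being coded by natural numbers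
(the two copies of `ℕ` are disjoint). -/
abbrev Trm := ℕ ⊕ ℕ

/-- A database schema assigns to every relation name (a natural number) an
arity `n` and a primary-key length `k` with `n ≥ k ≥ 1`; the primary key
consists of the first `k` positions. -/
structure Schema where
  arity : ℕ → ℕ
  keyLen : ℕ → ℕ
  keyLen_le_arity : ∀ R, keyLen R ≤ arity R
  one_le_keyLen : ∀ R, 1 ≤ keyLen R

/-- An atom: a relation name together with a list of arguments. -/
structure Atom where
  rel : ℕ
  args : List Trm
deriving DecidableEq

/-- Variables occurring in a list of terms. -/
def varsL (l : List Trm) : Finset ℕ := (l.filterMap Sum.getLeft?).toFinset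

/-- Constants occurring in a list of terms. -/
def constsL (l : List Trm) : Finset ℕ := (l.filterMap Sum.getRight?).toFinset

/-- All variables of an atom. -/
def varsA (A : Atom) : Finset ℕ := varsL A.args

/-- Key variables of an atom: variables in the primary-key positions. -/
def keyVars (S : Schema) (A : Atom) : Finset ℕ := varsL (A.args.take (S.keyLen A.rel))

/-- Constants of an atom. -/
def constsA (A : Atom) : Finset ℕ := constsL A.args

/-- Well-formed atom: number of arguments equals the arity of its relation name. -/
def wfAtom (S : Schema) (A : Atom) : Prop := A.args.length = S.arity A.rel

/-- A fact is an atom without variables. -/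
def isFact (A : Atom) : Prop := ∀ t ∈ A.args, ∃ c : ℕ, t = Sum.inr c

/-- Two (facts) are key-equal: same relation name, and same primary-key positions. -/
def keyEqual (S : Schema) (A B : Atom) : Prop :=
  A.rel = B.rel ∧ A.args.take (S.keyLen A.rel) = B.args.take (S.keyLen B.rel)

/-- The block of `A` in `db`: all facts of `db` key-equal to `A`. -/
def block (S : Schema) (A : Atom) (db : Finset Atom) : Finset Atom :=
  db.filter (fun B => keyEqual S A B)

/-- An uncertain database: a finite set of well-formed facts. -/
def IsDb (S : Schema) (db : Finset Atom) : Prop := ∀ A ∈ db, isFact A ∧ wfAtom S A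

/-- A set of facts is consistent if it contains no two distinct key-equal facts. -/
def Consistent (S : Schema) (db : Finset Atom) : Prop :=
  ∀ A ∈ db, ∀ B ∈ db, keyEqual S A B → A = B

/-- A repair of `db`: a maximal consistent subset of `db`. -/
def IsRepair (S : Schema) (db r : Finset Atom) : Prop :=
  r ⊆ db ∧ Consistent S r ∧
    ∀ r' : Finset Atom, r ⊆ r' → r' ⊆ db → Consistent S r' → r' = r

/-- Applying a valuation (a total map from variables to constants) to a term. -/
def appT (θ : ℕ → ℕ) : Trm → Trm
  | Sum.inl v => Sum.inr (θ v)
  | Sum.inr c => Sum.inr c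

/-- Applying a valuation to an atom. -/
def appA (θ : ℕ → ℕ) (A : Atom) : Atom := ⟨A.rel, A.args.map (appT θ)⟩

/-- Applying a valuation to a query. -/
def appQ (θ : ℕ → ℕ) (q : Finset Atom) : Finset Atom := q.image (appA θ)

/-- `db ⊨ q`: some valuation sends every atom of `q` into `db`. -/
def Sat (db q : Finset Atom) : Prop := ∃ θ : ℕ → ℕ, appQ θ q ⊆ db

/-- `db ∈ CERTAINTY(q)`: every repair of `db` satisfies `q`. -/
def Certainty (S : Schema) (q db : Finset Atom) : Prop :=
  ∀ r : Finset Atom, IsRepair S db r → Sat r q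

/-- Variables of a query. -/
def varsQ (q : Finset Atom) : Finset ℕ := q.biUnion varsA

/-- Constants of a query. -/
def constsQ (q : Finset Atom) : Finset ℕ := q.biUnion constsA

/-- `q` has no self-join: no two distinct atoms share a relation name. -/
def NoSelfJoin (q : Finset Atom) : Prop := ∀ F ∈ q, ∀ G ∈ q, F.rel = G.rel → F = G

/-- `db` is purified relative to `q`. -/
def Purified (q db : Finset Atom) : Prop :=
  ∀ A ∈ db, ∃ θ : ℕ → ℕ, A ∈ appQ θ q ∧ appQ θ q ⊆ db

/-- Active domain of a database: all constants occurring in its facts. -/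
def adom (db : Finset Atom) : Finset ℕ := db.biUnion constsA

/-- Membership in the attribute closure of `X` under a set `FDs` of
functional dependencies (standard implication of functional dependencies). -/
inductive InCl (FDs : Set (Finset ℕ × Finset ℕ)) (X : Finset ℕ) : ℕ → Prop
  | base {x : ℕ} : x ∈ X → InCl FDs X x
  | step {Z W : Finset ℕ} {w : ℕ} : (Z, W) ∈ FDs → (∀ z ∈ Z, InCl FDs X z) →
      w ∈ W → InCl FDs X w

/-- `FDs ⊨ X → Y`. -/
def FDImp (FDs : Set (Finset ℕ × Finset ℕ)) (X Y : Finset ℕ) : Prop :=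
  ∀ y ∈ Y, InCl FDs X y

/-- `FD(q) = { key(F) → vars(F) : F ∈ q }`. -/
def FDq (S : Schema) (q : Finset Atom) : Set (Finset ℕ × Finset ℕ) :=
  {p | ∃ F ∈ q, p = (keyVars S F, varsA F)}

/-- `F^{+,q} = {x ∈ vars(q) : FD(q \ {F}) ⊨ key(F) → x}`. -/
def plusCl (S : Schema) (q : Finset Atom) (F : Atom) : Set ℕ :=
  {x | x ∈ varsQ q ∧ InCl (FDq S (q.erase F)) (keyVars S F) x}

/-- `F^{⊕,q} = {x ∈ vars(q) : FD(q) ⊨ key(F) → x}`. -/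
def oplusCl (S : Schema) (q : Finset Atom) (F : Atom) : Set ℕ :=
  {x | x ∈ varsQ q ∧ InCl (FDq S q) (keyVars S F) x}

/-- A (simple) path in an undirected graph given by edge relation `E`. -/
def IsPath (E : Atom → Atom → Prop) (p : List Atom) : Prop :=
  p ≠ [] ∧ p.Nodup ∧ List.Chain' E p

/-- `E` is (the edge relation of) a join tree for `q`: a tree (unique simple
paths between any two vertices) on the atoms of `q` satisfying the
Connectedness Condition. -/
def IsJoinTree (q : Finset Atom) (E : Atom → Atom → Prop) : Prop :=
  (∀ a b, E a b → E b a) ∧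
  (∀ a b, E a b → a ∈ q ∧ b ∈ q ∧ a ≠ b) ∧
  (∀ a ∈ q, ∀ b ∈ q, ∃! p : List Atom,
      IsPath E p ∧ p.head? = some a ∧ p.getLast? = some b) ∧
  (∀ x : ℕ, ∀ F ∈ q, ∀ G ∈ q, x ∈ varsA F → x ∈ varsA G →
      ∀ p : List Atom, IsPath E p → p.head? = some F → p.getLast? = some G →
        ∀ H ∈ p, x ∈ varsA H)

/-- The consecutive pairs (edges) of a path. -/
def edgePairs (p : List Atom) : List (Atom × Atom) := p.zip p.tail

/-- `F ↝ G` in the attack graph of the join tree `E` of `q`: `F ≠ G` are atoms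
of `q`, and no label `vars(H) ∩ vars(H')` of an edge on the (unique) path from
`F` to `G` is contained in `F^{+,q}`. -/
def Attacks (S : Schema) (q : Finset Atom) (E : Atom → Atom → Prop) (F G : Atom) : Prop :=
  F ∈ q ∧ G ∈ q ∧ F ≠ G ∧
  ∀ p : List Atom, IsPath E p → p.head? = some F → p.getLast? = some G →
    ∀ e ∈ edgePairs p, ¬ ((↑(varsA e.1 ∩ varsA e.2) : Set ℕ) ⊆ plusCl S q F)

/-- The attack `F ↝ G` is weak: `key(G) ⊆ F^{⊕,q}`. -/
def Weak (S : Schema) (q : Finset Atom) (F G : Atom) : Prop :=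
  (↑(keyVars S G) : Set ℕ) ⊆ oplusCl S q F

/-- Consecutive pairs of a cyclic sequence, including the wrap-around pair. -/
def cyclePairs (L : List Atom) : List (Atom × Atom) := L.zip (L.rotate 1)

/-- `L` is an (elementary directed) cycle in the directed graph `att`. -/
def IsCycle (att : Atom → Atom → Prop) (L : List Atom) : Prop :=
  2 ≤ L.length ∧ L.Nodup ∧ ∀ e ∈ cyclePairs L, att e.1 e.2

/-- A cycle is terminal: no edge leads from a vertex in the cycle to a vertex
outside the cycle. -/
def TerminalCycle (att : Atom → Atom → Prop) (L : List Atom) : Prop :=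
  ∀ a ∈ L, ∀ b, att a b → b ∈ L

/-- A strong cycle in the attack graph: a cycle at least one attack of which is strong. -/
def StrongCycle (S : Schema) (q : Finset Atom) (E : Atom → Atom → Prop)
    (L : List Atom) : Prop :=
  IsCycle (Attacks S q E) L ∧ ∃ e ∈ cyclePairs L, ¬ Weak S q e.1 e.2

/-- Substituting constant `c` for variable `z` in a term. -/
def substT (z c : ℕ) : Trm → Trm
  | Sum.inl v => if v = z then Sum.inr c else Sum.inl v
  | Sum.inr d => Sum.inr d

/-- `F[z→c]`. -/
def substA (z c : ℕ) (A : Atom) : Atom := ⟨A.rel, A.args.map (substT z c)⟩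

/-- `q[z→c]`. -/
def substQ (z c : ℕ) (q : Finset Atom) : Finset Atom := q.image (substA z c)

/-- Simultaneous substitution of the constants `bs` for the (distinct)
variables `xs` (componentwise) in a term. -/
def substLT (xs bs : List ℕ) : Trm → Trm
  | Sum.inl v => if v ∈ xs then Sum.inr (bs.getD (xs.idxOf v) 0) else Sum.inl v
  | Sum.inr d => Sum.inr d

/-- `F[x⃗→b⃗]`. -/
def substLA (xs bs : List ℕ) (A : Atom) : Atom := ⟨A.rel, A.args.map (substLT xs bs)⟩

/-- `q[x⃗→b⃗]`. -/
def substLQ (xs bs : List ℕ) (q : Finset Atom) : Finset Atom := q.image (substLA xs bs)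

/-- First-order formulas over the relational vocabulary (relation names and
constants coded by naturals, variables coded by naturals). -/
inductive Fml where
  | atom (R : ℕ) (args : List Trm)
  | eq (s t : Trm)
  | tru
  | not (φ : Fml)
  | and (φ ψ : Fml)
  | or (φ ψ : Fml)
  | ex (v : ℕ) (φ : Fml)
  | all (v : ℕ) (φ : Fml)

/-- Value of a term under an assignment of constants to variables. -/
def evalT (σ : ℕ → ℕ) : Trm → ℕ
  | Sum.inl v => σ v
  | Sum.inr c => c

/-- Satisfaction of a first-order formula in the finite structure whose
relations are given by the facts of `db`, with quantifiers ranging over `dom`. -/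
def Holds (db : Finset Atom) (dom : Finset ℕ) : Fml → (ℕ → ℕ) → Prop
  | .atom R args, σ => (⟨R, args.map fun t => Sum.inr (evalT σ t)⟩ : Atom) ∈ db
  | .eq s t, σ => evalT σ s = evalT σ t
  | .tru, _ => True
  | .not φ, σ => ¬ Holds db dom φ σ
  | .and φ ψ, σ => Holds db dom φ σ ∧ Holds db dom ψ σ
  | .or φ ψ, σ => Holds db dom φ σ ∨ Holds db dom ψ σ
  | .ex v φ, σ => ∃ a ∈ dom, Holds db dom φ (Function.update σ v a)
  | .all v φ, σ => ∀ a ∈ dom, Holds db dom φ (Function.update σ v a)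

/-- Free variables of a formula. -/
def Fml.free : Fml → Finset ℕ
  | .atom _ args => varsL args
  | .eq s t => varsL [s, t]
  | .tru => ∅
  | .not φ => φ.free
  | .and φ ψ => φ.free ∪ ψ.free
  | .or φ ψ => φ.free ∪ ψ.free
  | .ex v φ => φ.free.erase v
  | .all v φ => φ.free.erase v

/-- Relation names occurring in a formula. -/
def Fml.rels : Fml → Finset ℕ
  | .atom R _ => {R}
  | .eq _ _ => ∅
  | .tru => ∅
  | .not φ => φ.rels
  | .and φ ψ => φ.rels ∪ ψ.rels
  | .or φ ψ => φ.rels ∪ ψ.rels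
  | .ex _ φ => φ.rels
  | .all _ φ => φ.rels

/-- Constants occurring in a formula. -/
def Fml.consts : Fml → Finset ℕ
  | .atom _ args => constsL args
  | .eq s t => constsL [s, t]
  | .tru => ∅
  | .not φ => φ.consts
  | .and φ ψ => φ.consts ∪ ψ.consts
  | .or φ ψ => φ.consts ∪ ψ.consts
  | .ex _ φ => φ.consts
  | .all _ φ => φ.consts

/-- Well-formed formula: every atom has as many arguments as the arity of its
relation name. -/
def FmlWf (S : Schema) : Fml → Prop
  | .atom R args => args.length = S.arity R
  | .eq _ _ => True
  | .tru => True
  | .not φ => FmlWf S φ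
  | .and φ ψ => FmlWf S φ ∧ FmlWf S ψ
  | .or φ ψ => FmlWf S φ ∧ FmlWf S ψ
  | .ex _ φ => FmlWf S φ
  | .all _ φ => FmlWf S φ

/-- The safety predicate of Dalvi, Ré and Suciu (rules SE1–SE4). -/
inductive Safe (S : Schema) : Finset Atom → Prop
  | se1 (A : Atom) : isFact A → Safe S {A}
  | se2 (q₁ q₂ : Finset Atom) : q₁.Nonempty → q₂.Nonempty →
      Disjoint (varsQ q₁) (varsQ q₂) → Safe S q₁ → Safe S q₂ → Safe S (q₁ ∪ q₂)
  | se3 (q : Finset Atom) (x a : ℕ) : (∀ F ∈ q, x ∈ keyVars S F) →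
      Safe S (substQ x a q) → Safe S q
  | se4 (q : Finset Atom) (F : Atom) (x a : ℕ) : F ∈ q → keyVars S F = ∅ →
      varsA F ≠ ∅ → x ∈ varsA F → Safe S (substQ x a q) → Safe S q

/-- The atom `R_i(x_i ; x_{i+1})` (with `x_{k+1} = x_1`) of the query `acq_k`;
variable `x_i` is coded by `i`, relation name `R_i` by `i`. -/
def Ratom (k i : ℕ) : Atom := ⟨i, [Sum.inl i, Sum.inl (i % k + 1)]⟩

/-- The all-key atom `S_k(x_1,…,x_k)` of the query `acq_k`;
relation name `S_k` is coded by `0`. -/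
def Satom (k : ℕ) : Atom := ⟨0, (List.range k).map (fun j => Sum.inl (j + 1))⟩

/-- The query `acq_k = {R_1(x_1;x_2), …, R_k(x_k;x_1), S_k(x_1,…,x_k)}`. -/
def acq (k : ℕ) : Finset Atom := ((Finset.Icc 1 k).image (Ratom k)) ∪ {Satom k}

/-- Sum of `Pr` over the possible (= consistent) worlds of `db` satisfying `P`. -/
def prOf (S : Schema) (db : Finset Atom) (Pr : Finset Atom → ℚ)
    (P : Finset Atom → Prop) : ℚ :=
  ∑ w ∈ db.powerset.filter (fun w => Consistent S w ∧ P w), Pr w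

end
theorem mem_varsL (l : List Trm) (v : ℕ) : v ∈ varsL l ↔ (Sum.inl v : Trm) ∈ l := by
  simp [varsL, List.mem_filterMap, Sum.getLeft?_eq_some_iff]

theorem mem_constsL (l : List Trm) (v : ℕ) : v ∈ constsL l ↔ (Sum.inr v : Trm) ∈ l := by
  simp [constsL, List.mem_filterMap, Sum.getRight?_eq_some_iff]

/-- The valuation sending the listed variables to the listed constants, and
agreeing with `θ` elsewhere. -/
noncomputable def mixV (ys bs : List ℕ) (θ : ℕ → ℕ) : ℕ → ℕ :=
  fun v => if v ∈ ys then bs.getD (ys.idxOf v) 0 else θ v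

theorem appA_substLA (ys bs : List ℕ) (θ : ℕ → ℕ) (G : Atom) :
    appA θ (substLA ys bs G) = appA (mixV ys bs θ) G := by
  simp only [appA, substLA, List.map_map, Atom.mk.injEq, true_and]
  apply List.map_congr_left
  rintro (v | c) _
  · by_cases h : v ∈ ys <;> simp [substLT, appT, mixV, h]
  · simp [substLT, appT]

theorem substLA_eq (ys bs : List ℕ) (θ : ℕ → ℕ) (G : Atom) (h : ∀ v ∈ varsA G, v ∈ ys) :
    substLA ys bs G = appA (mixV ys bs θ) G := by
  simp only [appA, substLA, Atom.mk.injEq, true_and]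
  apply List.map_congr_left
  rintro (v | c) hv
  · have := h v ((mem_varsL _ _).2 hv)
    simp [substLT, appT, mixV, this]
  · simp [substLT, appT]

theorem appA_congr (θ θ' : ℕ → ℕ) (G : Atom) :
    appA θ G = appA θ' G ↔ ∀ v ∈ varsA G, θ v = θ' v := by
  simp only [appA, Atom.mk.injEq, true_and, List.map_inj_left]
  constructor
  · intro h v hv
    simpa [appT] using h _ ((mem_varsL _ _).1 hv)
  · rintro h (v | c) hv
    · simpa [appT] using h v ((mem_varsL _ _).2 hv)
    · rfl

theorem keyEqual_app (S : Schema) (F : Atom) (hkey : keyVars S F = ∅) (θ θ' : ℕ → ℕ) :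
    keyEqual S (appA θ F) (appA θ' F) := by
  refine ⟨rfl, ?_⟩
  simp only [appA, ← List.map_take]
  apply List.map_congr_left
  rintro (v | c) hv
  · have := (mem_varsL _ _).2 hv
    rw [show varsL (F.args.take (S.keyLen F.rel)) = ∅ from hkey] at this
    simp at this
  · rfl

theorem keyEqual_symm' {S : Schema} {A B : Atom} (h : keyEqual S A B) : keyEqual S B A :=
  ⟨h.1.symm, h.2.symm⟩

theorem keyEqual_trans' {S : Schema} {A B C : Atom} (h : keyEqual S A B)
    (h' : keyEqual S B C) : keyEqual S A C :=
  ⟨h.1.trans h'.1, h.2.trans h'.2⟩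

theorem repair_meets {S : Schema} {db r : Finset Atom} (hr : IsRepair S db r) {A : Atom}
    (hA : A ∈ db) : ∃ B ∈ r, keyEqual S A B := by
  by_contra hcon
  push Not at hcon
  have h := hr.2.2 (insert A r) (Finset.subset_insert _ _)
    (Finset.insert_subset hA hr.1) (by
      intro B hB C hC hBC
      rcases Finset.mem_insert.1 hB with rfl | hB' <;>
        rcases Finset.mem_insert.1 hC with rfl | hC'
      · rfl
      · exact absurd hBC (hcon _ hC')
      · exact absurd (keyEqual_symm' hBC) (hcon _ hB')
      · exact hr.2.1 _ hB' _ hC' hBC)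
  have hAr : A ∈ r := h ▸ Finset.mem_insert_self A r
  exact hcon A hAr ⟨rfl, rfl⟩

theorem repair_of_meets {S : Schema} {db r : Finset Atom} (h1 : r ⊆ db) (h2 : Consistent S r)
    (h3 : ∀ A ∈ db, ∃ B ∈ r, keyEqual S A B) : IsRepair S db r := by
  refine ⟨h1, h2, fun r' hrr' hr'db hc => Finset.Subset.antisymm ?_ hrr'⟩
  intro A hA
  obtain ⟨B, hB, hAB⟩ := h3 A (hr'db hA)
  rw [hc A hA B (hrr' hB) hAB]
  exact hB

theorem repair_swap {S : Schema} {db r : Finset Atom} (hr : IsRepair S db r) {A : Atom}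
    (hA : A ∈ db) : IsRepair S db (insert A (r.filter fun B => ¬ keyEqual S A B)) := by
  apply repair_of_meets
  · exact Finset.insert_subset hA ((Finset.filter_subset _ _).trans hr.1)
  · intro B hB C hC hBC
    rcases Finset.mem_insert.1 hB with rfl | hB' <;>
        rcases Finset.mem_insert.1 hC with rfl | hC'
    · rfl
    · exact absurd hBC (Finset.mem_filter.1 hC').2
    · exact absurd (keyEqual_symm' hBC) (Finset.mem_filter.1 hB').2
    · exact hr.2.1 _ (Finset.mem_filter.1 hB').1 _ (Finset.mem_filter.1 hC').1 hBC
  · intro B hB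
    by_cases h : keyEqual S A B
    · exact ⟨A, Finset.mem_insert_self _ _, keyEqual_symm' h⟩
    · obtain ⟨C, hC, hBC⟩ := repair_meets hr hB
      refine ⟨C, Finset.mem_insert_of_mem (Finset.mem_filter.2 ⟨hC, fun h' => h ?_⟩), hBC⟩
      exact keyEqual_trans' h' (keyEqual_symm' hBC)

theorem mem_appQ {θ : ℕ → ℕ} {q : Finset Atom} {A : Atom} :
    A ∈ appQ θ q ↔ ∃ G ∈ q, appA θ G = A := by
  simp [appQ]

/-- Lemma for an atom `F` with `key(F) = ∅`: for purified `db`,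
`db ∈ CERTAINTY(q)` iff `db ≠ ∅` and for all tuples `b⃗` of active-domain
constants, `F[y⃗→b⃗] ∈ db` implies `db ∈ CERTAINTY((q \ {F})[y⃗→b⃗])`. -/
theorem statement10 (S : Schema) (q : Finset Atom) (hq : ∀ F ∈ q, wfAtom S F)
    (hnsj : NoSelfJoin q) (F : Atom) (hF : F ∈ q) (hkey : keyVars S F = ∅)
    (ys : List ℕ) (hnd : ys.Nodup) (hys : ys.toFinset = varsA F)
    (db : Finset Atom) (hdb : IsDb S db) (hpur : Purified q db) :
    Certainty S q db ↔
      (db.Nonempty ∧ ∀ bs : List ℕ, bs.length = ys.length →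
        (∀ b ∈ bs, b ∈ adom db) → substLA ys bs F ∈ db →
        Certainty S (substLQ ys bs (q.erase F)) db) := by
  have hv : ∀ v ∈ varsA F, v ∈ ys := fun v h => by
    rw [← hys] at h; simpa using h
  have hv' : ∀ v ∈ ys, v ∈ varsA F := fun v h => by
    rw [← hys]; simpa using h
  constructor
  · intro hC
    constructor
    · rw [Finset.nonempty_iff_ne_empty]
      rintro rfl
      obtain ⟨θ, hθ⟩ := hC ∅ (repair_of_meets (by simp) (by simp [Consistent]) (by simp))
      simpa using hθ (mem_appQ.2 ⟨F, hF, rfl⟩)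
    · intro bs _ _ hA r hr
      obtain ⟨θ, hθ⟩ := hC _ (repair_swap hr hA)
      have hθF := hθ (mem_appQ.2 ⟨F, hF, rfl⟩)
      have hke : keyEqual S (substLA ys bs F) (appA θ F) := by
        rw [substLA_eq ys bs θ F hv]
        exact keyEqual_app S F hkey _ _
      have hEq : appA (mixV ys bs θ) F = appA θ F := by
        rcases Finset.mem_insert.1 hθF with h | h
        · rw [h, substLA_eq ys bs θ F hv]
        · exact absurd hke (Finset.mem_filter.1 h).2
      have hmix : mixV ys bs θ = θ := by
        funext v
        by_cases h : v ∈ ys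
        · exact (appA_congr _ _ _).1 hEq v (hv' v h)
        · simp [mixV, h]
      refine ⟨θ, ?_⟩
      intro B hB
      obtain ⟨G', hG', rfl⟩ := mem_appQ.1 hB
      obtain ⟨G, hG, rfl⟩ := Finset.mem_image.1 hG'
      rw [appA_substLA, hmix]
      obtain ⟨hne, hGq⟩ := Finset.mem_erase.1 hG
      rcases Finset.mem_insert.1 (hθ (mem_appQ.2 ⟨G, hGq, rfl⟩)) with h | h
      · exact absurd (hnsj G hGq F hF (show (appA θ G).rel = (substLA ys bs F).rel from congrArg Atom.rel h)) hne
      · exact (Finset.mem_filter.1 h).1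
  · rintro ⟨⟨A₀, hA₀⟩, hall⟩ r hr
    obtain ⟨θ₀, -, hθ₀⟩ := hpur A₀ hA₀
    obtain ⟨A, hAr, hkA⟩ := repair_meets hr (hθ₀ (mem_appQ.2 ⟨F, hF, rfl⟩))
    obtain ⟨θ₁, hA1, -⟩ := hpur A (hr.1 hAr)
    obtain ⟨G, hG, rfl⟩ := mem_appQ.1 hA1
    obtain rfl : F = G := hnsj F hF G hG hkA.1
    have hmixv : ∀ θ, ∀ v ∈ ys, mixV ys (ys.map θ₁) θ v = θ₁ v := by
      intro θ v h
      have hlt : ys.idxOf v < ys.length := List.idxOf_lt_length_iff.2 h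
      simp only [mixV, if_pos h]
      rw [List.getD_eq_getElem _ _ (by simpa using hlt)]
      simp
    have hmixF : ∀ θ, appA (mixV ys (ys.map θ₁) θ) F = appA θ₁ F := fun θ =>
      (appA_congr _ _ _).2 fun v h => hmixv θ v (hv v h)
    obtain ⟨θ, hθ⟩ := hall (ys.map θ₁) (by simp) (by
      intro b hb
      obtain ⟨v, hvy, rfl⟩ := List.mem_map.1 hb
      refine Finset.mem_biUnion.2 ⟨_, hr.1 hAr, (mem_constsL _ _).2 ?_⟩
      exact List.mem_map.2 ⟨Sum.inl v, (mem_varsL _ _).1 (hv' v hvy), rfl⟩) (by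
      rw [substLA_eq ys _ θ₁ F hv, hmixF]
      exact hr.1 hAr) r hr
    refine ⟨mixV ys (ys.map θ₁) θ, ?_⟩
    intro B hB
    obtain ⟨G, hG, rfl⟩ := mem_appQ.1 hB
    by_cases h : G = F
    · rw [h, hmixF]
      exact hAr
    · rw [← appA_substLA]
      exact hθ (mem_appQ.2 ⟨_, Finset.mem_image.2 ⟨G, Finset.mem_erase.2 ⟨h, hG⟩, rfl⟩, rfl⟩)
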